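/- Let g = g₀ ⊕ g₁ be a non-degenerate filiform Lie superalgebra over ℂ with dim g₀ = 4 and dim g₁ = 4. If g is naturally graded, then g is isomorphic to exactly one of the following three pairwise non-isomorphic Lie superalgebras on a basis {X₀,X₁,X₂,X₃,Y₁,Y₂,Y₃,Y₄}, where in all three [X₀,X_i] = X_{i+1} for 1 ≤ i ≤ 2, [X₀,Y_j] = Y_{j+1} for 1 ≤ j ≤ 3, (Y₁,Y₁) = X₂ and (Y₁,Y₂) = (1/2)X₃: (I) no further nonzero products; (II) additionally [X₁,Y₃] = Y₄, [X₂,Y₂] = −Y₄, [X₃,Y₁] = Y₄; (III) additionally [X₁,Y_j] = Y_{j+1} for 1 ≤ j ≤ 3. -/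

import Mathlib

/-- The sign `(-1)^(i·j)` for parities `i j : ZMod 2`, as a complex scalar. -/
def ssign (i j : ZMod 2) : ℂ := if i = 1 ∧ j = 1 then -1 else 1

/-- A (complex) Lie superalgebra structure on the vector space `V`: a ℤ₂-grading
`g` whose parts are complementary, together with an even bilinear bracket which is
super skew-symmetric and satisfies the super Jacobi identity on homogeneous elements. -/
structure LieSuperAlg (V : Type*) [AddCommGroup V] [Module ℂ V] where
  g : ZMod 2 → Submodule ℂ V
  bk : V →ₗ[ℂ] V →ₗ[ℂ] V
  compl : IsCompl (g 0) (g 1)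
  grading : ∀ i j : ZMod 2, ∀ x ∈ g i, ∀ y ∈ g j, bk x y ∈ g (i + j)
  skew : ∀ i j : ZMod 2, ∀ x ∈ g i, ∀ y ∈ g j, bk x y = -(ssign i j • bk y x)
  jacobi : ∀ i j k : ZMod 2, ∀ x ∈ g i, ∀ y ∈ g j, ∀ z ∈ g k,
    ssign k i • bk x (bk y z) + ssign i j • bk y (bk z x) + ssign j k • bk z (bk x y) = 0

namespace LieSuperAlg

variable {V : Type*} [AddCommGroup V] [Module ℂ V]

/-- The descending sequences `C⁰(g_i) = g_i`, `C^{k+1}(g_i) = [g₀, C^k(g_i)]`. -/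
def C (A : LieSuperAlg V) (i : ZMod 2) : ℕ → Submodule ℂ V
  | 0 => A.g i
  | k + 1 => Submodule.span ℂ {z | ∃ x ∈ A.g 0, ∃ y ∈ C A i k, z = A.bk x y}

/-- The descending central sequence of the whole superalgebra. -/
def DC (A : LieSuperAlg V) : ℕ → Submodule ℂ V
  | 0 => ⊤
  | k + 1 => Submodule.span ℂ {z | ∃ x ∈ DC A k, ∃ y : V, z = A.bk x y}

/-- Nilpotency: the descending central sequence reaches zero. -/
def IsNilpotent (A : LieSuperAlg V) : Prop := ∃ k, A.DC k = ⊥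

/-- `A` is filiform with parameters `(n, m)`: it is nilpotent, `dim g₀ = n + 1`,
`dim g₁ = m`, and the super-nilindex is `(n, m)` (the maximal one). -/
def IsFiliform (A : LieSuperAlg V) (n m : ℕ) : Prop :=
  A.IsNilpotent ∧ Module.finrank ℂ (A.g 0) = n + 1 ∧ Module.finrank ℂ (A.g 1) = m ∧
    A.C 0 (n - 1) ≠ ⊥ ∧ A.C 1 (m - 1) ≠ ⊥ ∧ A.C 0 n = ⊥ ∧ A.C 1 m = ⊥

/-- Non-degeneracy: the bracket does not vanish identically on `g₁ × g₁`. -/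
def NonDegenerate (A : LieSuperAlg V) : Prop :=
  ∃ x ∈ A.g 1, ∃ y ∈ A.g 1, A.bk x y ≠ 0

/-- `A` is naturally graded: there are subspaces `W a i` (`i ≥ 1`, parity `a`), splitting
the filtrations `C` (so that `W a i ≅ C^{i-1}(g_a)/C^i(g_a)` and `g ≅ gr(g)` in the
natural way) and compatible with the bracket (so `gr(g)` is a graded Lie superalgebra,
`[gⁱ, gʲ] ⊆ g^{i+j}`).  For finite-dimensional nilpotent superalgebras this is
equivalent to the textbook definition `g ≅ gr(g)` with `gr(g)` graded. -/
def NaturallyGraded (A : LieSuperAlg V) : Prop :=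
  ∃ W : ZMod 2 → ℕ → Submodule ℂ V,
    (∀ a, W a 0 = ⊥) ∧
    (∀ a k, A.C a k = W a (k + 1) ⊔ A.C a (k + 1)) ∧
    (∀ a k, W a (k + 1) ⊓ A.C a (k + 1) = ⊥) ∧
    (∀ a b : ZMod 2, ∀ i j : ℕ, ∀ x ∈ W a i, ∀ y ∈ W b j, A.bk x y ∈ W (a + b) (i + j))

/-- `X 0, …, X n` and `Y 1, …, Y m` form an adapted basis of the superalgebra:
the `X i` are even, the `Y j` are odd, and together they form a basis of `V`. -/
def IsAdaptedBasis (A : LieSuperAlg V) (n m : ℕ) (X Y : ℕ → V) : Prop :=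
  (∀ i, i ≤ n → X i ∈ A.g 0) ∧ (∀ j, 1 ≤ j → j ≤ m → Y j ∈ A.g 1) ∧
  LinearIndependent ℂ
    (Sum.elim (fun i : Fin (n + 1) => X i.val) (fun j : Fin m => Y (j.val + 1))) ∧
  Submodule.span ℂ
    (Set.range (Sum.elim (fun i : Fin (n + 1) => X i.val) (fun j : Fin m => Y (j.val + 1)))) = ⊤

end LieSuperAlg

/-- The law `L^{3,4} + φ₁₂`. -/
def Law34I {V : Type*} [AddCommGroup V] [Module ℂ V] (A : LieSuperAlg V) : Prop :=
  ∃ X Y : ℕ → V, A.IsAdaptedBasis 3 4 X Y ∧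
    (∀ i j : ℕ, i ≤ 3 → j ≤ 3 → A.bk (X i) (X j) =
      if i = 0 ∧ 1 ≤ j ∧ j ≤ 2 then X (j + 1)
      else if j = 0 ∧ 1 ≤ i ∧ i ≤ 2 then -X (i + 1) else 0) ∧
    (∀ i j : ℕ, i ≤ 3 → 1 ≤ j → j ≤ 4 → A.bk (X i) (Y j) =
      if i = 0 ∧ j ≤ 3 then Y (j + 1) else 0) ∧
    (∀ i j : ℕ, 1 ≤ i → i ≤ 4 → 1 ≤ j → j ≤ 4 → A.bk (Y i) (Y j) =
      if i = 1 ∧ j = 1 then X 2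
      else if (i = 1 ∧ j = 2) ∨ (i = 2 ∧ j = 1) then (1/2 : ℂ) • X 3 else 0)

/-- The law `L^{3,4} + φ₁₂ + Ψ⁴₃₁`. -/
def Law34II {V : Type*} [AddCommGroup V] [Module ℂ V] (A : LieSuperAlg V) : Prop :=
  ∃ X Y : ℕ → V, A.IsAdaptedBasis 3 4 X Y ∧
    (∀ i j : ℕ, i ≤ 3 → j ≤ 3 → A.bk (X i) (X j) =
      if i = 0 ∧ 1 ≤ j ∧ j ≤ 2 then X (j + 1)
      else if j = 0 ∧ 1 ≤ i ∧ i ≤ 2 then -X (i + 1) else 0) ∧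
    (∀ i j : ℕ, i ≤ 3 → 1 ≤ j → j ≤ 4 → A.bk (X i) (Y j) =
      if i = 0 ∧ j ≤ 3 then Y (j + 1)
      else if i = 1 ∧ j = 3 then Y 4
      else if i = 2 ∧ j = 2 then -Y 4
      else if i = 3 ∧ j = 1 then Y 4 else 0) ∧
    (∀ i j : ℕ, 1 ≤ i → i ≤ 4 → 1 ≤ j → j ≤ 4 → A.bk (Y i) (Y j) =
      if i = 1 ∧ j = 1 then X 2
      else if (i = 1 ∧ j = 2) ∨ (i = 2 ∧ j = 1) then (1/2 : ℂ) • X 3 else 0)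

/-- The law `L^{3,4} + φ₁₂ + Ψ²₁₁`. -/
def Law34III {V : Type*} [AddCommGroup V] [Module ℂ V] (A : LieSuperAlg V) : Prop :=
  ∃ X Y : ℕ → V, A.IsAdaptedBasis 3 4 X Y ∧
    (∀ i j : ℕ, i ≤ 3 → j ≤ 3 → A.bk (X i) (X j) =
      if i = 0 ∧ 1 ≤ j ∧ j ≤ 2 then X (j + 1)
      else if j = 0 ∧ 1 ≤ i ∧ i ≤ 2 then -X (i + 1) else 0) ∧
    (∀ i j : ℕ, i ≤ 3 → 1 ≤ j → j ≤ 4 → A.bk (X i) (Y j) =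
      if (i = 0 ∨ i = 1) ∧ j ≤ 3 then Y (j + 1) else 0) ∧
    (∀ i j : ℕ, 1 ≤ i → i ≤ 4 → 1 ≤ j → j ≤ 4 → A.bk (Y i) (Y j) =
      if i = 1 ∧ j = 1 then X 2
      else if (i = 1 ∧ j = 2) ∨ (i = 2 ∧ j = 1) then (1/2 : ℂ) • X 3 else 0)

namespace LieSuperAlg

section Identities

variable {V : Type*} [AddCommGroup V] [Module ℂ V] (A : LieSuperAlg V)

lemma bk_even_swap {x y : V} {i : ZMod 2} (hx : x ∈ A.g 0) (hy : y ∈ A.g i) :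
    A.bk x y = -A.bk y x := by
  simpa [ssign] using A.skew 0 i x hx y hy

lemma bk_swap_even {x y : V} {i : ZMod 2} (hx : x ∈ A.g 0) (hy : y ∈ A.g i) :
    A.bk y x = -A.bk x y := by
  rw [A.bk_even_swap hx hy, neg_neg]

lemma bk_odd_comm {x y : V} (hx : x ∈ A.g 1) (hy : y ∈ A.g 1) :
    A.bk x y = A.bk y x := by
  simpa [ssign] using A.skew 1 1 x hx y hy

lemma bk_even_self {x : V} (hx : x ∈ A.g 0) : A.bk x x = 0 := by
  have h : (2 : ℂ) • A.bk x x = 0 := by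
    linear_combination (norm := module) (1 : ℂ) • A.bk_even_swap hx hx
  exact (smul_eq_zero.mp h).resolve_left two_ne_zero

lemma bk_bk_even_even {x y z : V} {k : ZMod 2} (hx : x ∈ A.g 0) (hy : y ∈ A.g 0)
    (hz : z ∈ A.g k) : A.bk (A.bk x y) z = A.bk x (A.bk y z) - A.bk y (A.bk x z) := by
  have h := A.jacobi 0 0 k x hx y hy z hz
  have hxy : A.bk x y ∈ A.g 0 := by simpa using A.grading 0 0 x hx y hy
  rw [A.bk_swap_even hx hz, A.bk_swap_even hxy hz] at h
  simp only [ssign, map_neg] at h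
  simp at h
  linear_combination (norm := module) (-1 : ℂ) • h

lemma bk_even_bk_odd_odd {x y z : V} (hx : x ∈ A.g 0) (hy : y ∈ A.g 1)
    (hz : z ∈ A.g 1) : A.bk x (A.bk y z) = A.bk (A.bk x y) z + A.bk y (A.bk x z) := by
  have h := A.jacobi 0 1 1 x hx y hy z hz
  have hxy : A.bk x y ∈ A.g 1 := by simpa using A.grading 0 1 x hx y hy
  rw [A.bk_swap_even hx hz, A.bk_odd_comm hz hxy] at h
  simp [ssign] at h
  linear_combination (norm := module) (1 : ℂ) • h

lemma bk_bk_odd_self {y : V} (hy : y ∈ A.g 1) : A.bk (A.bk y y) y = 0 := by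
  have h := A.jacobi 1 1 1 y hy y hy y hy
  have hyy : A.bk y y ∈ A.g 0 := by
    have := A.grading 1 1 y hy y hy
    rwa [show (1 + 1 : ZMod 2) = 0 from rfl] at this
  rw [A.bk_swap_even hyy hy] at h
  simp only [ssign, and_self, if_true] at h
  have h3 : (3 : ℂ) • A.bk (A.bk y y) y = 0 := by
    linear_combination (norm := module) (1 : ℂ) • h
  exact (smul_eq_zero.mp h3).resolve_left (by norm_num)

lemma finrank_eq [FiniteDimensional ℂ V] {n m : ℕ} (h : A.IsFiliform n m) :
    Module.finrank ℂ V = n + 1 + m := by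
  rw [← Submodule.finrank_add_eq_of_isCompl A.compl, h.2.1, h.2.2.1]

end Identities

/-- `W` is a grading of `A` splitting the descending sequences `C`. -/
def IsNaturalGrading {V : Type*} [AddCommGroup V] [Module ℂ V] (A : LieSuperAlg V)
    (W : ZMod 2 → ℕ → Submodule ℂ V) : Prop :=
  (∀ a, W a 0 = ⊥) ∧
    (∀ a k, A.C a k = W a (k + 1) ⊔ A.C a (k + 1)) ∧
    (∀ a k, W a (k + 1) ⊓ A.C a (k + 1) = ⊥) ∧
    (∀ a b : ZMod 2, ∀ i j : ℕ, ∀ x ∈ W a i, ∀ y ∈ W b j, A.bk x y ∈ W (a + b) (i + j))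

section Grading

variable {V : Type*} [AddCommGroup V] [Module ℂ V] {A : LieSuperAlg V}

lemma bk_mem_C {a : ZMod 2} {k : ℕ} {x y : V} (hx : x ∈ A.g 0) (hy : y ∈ A.C a k) :
    A.bk x y ∈ A.C a (k + 1) :=
  Submodule.subset_span ⟨x, hx, y, hy, rfl⟩

lemma C_succ_congr {a : ZMod 2} {k l : ℕ} (h : A.C a k = A.C a l) :
    A.C a (k + 1) = A.C a (l + 1) := by
  simp only [C, h]

lemma C_eq_bot_of_le {a : ZMod 2} {k l : ℕ} (hkl : k ≤ l) (h : A.C a k = ⊥) :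
    A.C a l = ⊥ := by
  induction l, hkl using Nat.le_induction with
  | base => exact h
  | succ l _ ih =>
    rw [eq_bot_iff]
    refine Submodule.span_le.mpr ?_
    rintro _ ⟨x, -, y, hy, rfl⟩
    rw [ih, Submodule.mem_bot] at hy
    simp [hy]

/-- A repetition in the descending sequence forces it to be constant from there on. -/
lemma C_stable {a : ZMod 2} {k l : ℕ} (hkl : k ≤ l) (h : A.C a k = A.C a (k + 1)) :
    A.C a k = A.C a l := by
  induction l, hkl using Nat.le_induction with
  | base => rfl
  | succ l _ ih => exact h.trans (C_succ_congr ih)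

lemma C_succ_ne {a : ZMod 2} {k l : ℕ} (hk : A.C a k ≠ ⊥) (hl : A.C a l = ⊥) :
    A.C a k ≠ A.C a (k + 1) := by
  intro h
  rcases le_total k l with hkl | hkl
  · exact hk ((C_stable hkl h).trans hl)
  · exact hk (C_eq_bot_of_le hkl hl)

lemma exists_smul_eq {S : Submodule ℂ V} (hS : Module.finrank ℂ S = 1) {x y : V} (hx : x ∈ S)
    (hx0 : x ≠ 0) (hy : y ∈ S) : ∃ c : ℂ, c • x = y := by
  obtain ⟨c, hc⟩ := exists_smul_eq_of_finrank_eq_one hS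
    (x := (⟨x, hx⟩ : S)) (by simpa using hx0) ⟨y, hy⟩
  exact ⟨c, congrArg Subtype.val hc⟩

namespace IsNaturalGrading

variable {W : ZMod 2 → ℕ → Submodule ℂ V}

lemma C_succ_le (hW : A.IsNaturalGrading W) (a : ZMod 2) (k : ℕ) : A.C a (k + 1) ≤ A.C a k := by
  rw [hW.2.1 a k]
  exact le_sup_right

lemma C_le_g (hW : A.IsNaturalGrading W) (a : ZMod 2) (k : ℕ) : A.C a k ≤ A.g a := by
  induction k with
  | zero => exact le_rfl
  | succ k ih => exact (hW.C_succ_le a k).trans ih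

lemma W_le_C (hW : A.IsNaturalGrading W) (a : ZMod 2) (k : ℕ) : W a (k + 1) ≤ A.C a k := by
  rw [hW.2.1 a k]
  exact le_sup_left

lemma W_le_g (hW : A.IsNaturalGrading W) (a : ZMod 2) : ∀ k : ℕ, W a k ≤ A.g a
  | 0 => by simp [hW.1 a]
  | k + 1 => (hW.W_le_C a k).trans (hW.C_le_g a k)

lemma bk_mem (hW : A.IsNaturalGrading W)
    {a b : ZMod 2} {i j : ℕ} {x y : V} (hx : x ∈ W a i) (hy : y ∈ W b j) :
    A.bk x y ∈ W (a + b) (i + j) :=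
  hW.2.2.2 a b i j x hx y hy

lemma W_eq_bot (hW : A.IsNaturalGrading W)
    {a : ZMod 2} {k l : ℕ} (hkl : k < l) (h : A.C a k = ⊥) : W a l = ⊥ := by
  obtain ⟨l, rfl⟩ := Nat.exists_eq_succ_of_ne_zero (Nat.ne_zero_of_lt hkl)
  exact eq_bot_iff.mpr ((hW.W_le_C a l).trans (C_eq_bot_of_le (Nat.le_of_lt_succ hkl) h).le)

lemma W_ne_bot (hW : A.IsNaturalGrading W)
    {a : ZMod 2} {k l : ℕ} (hk : A.C a k ≠ ⊥) (hl : A.C a l = ⊥) :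
    W a (k + 1) ≠ ⊥ := by
  intro h
  refine C_succ_ne hk hl ?_
  rw [hW.2.1 a k, h, bot_sup_eq]

lemma finrank_C (hW : A.IsNaturalGrading W) [FiniteDimensional ℂ V] (a : ZMod 2) (k : ℕ) :
    Module.finrank ℂ (A.C a k) = Module.finrank ℂ (W a (k + 1)) +
      Module.finrank ℂ (A.C a (k + 1)) := by
  have h := Submodule.finrank_sup_add_finrank_inf_eq (W a (k + 1)) (A.C a (k + 1))
  rw [← hW.2.1 a k, hW.2.2.1 a k, finrank_bot, add_zero] at h
  exact h

lemma bk_C_one_mem (hW : A.IsNaturalGrading W)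
    {a : ZMod 2} {k : ℕ} {x y : V} (hx : x ∈ A.C 0 1) (hy : y ∈ A.C a k) :
    A.bk x y ∈ A.C a (k + 2) := by
  have hle : A.C 0 1 ≤ (A.C a (k + 2)).comap (A.bk.flip y) := by
    refine Submodule.span_le.mpr ?_
    rintro _ ⟨u, hu, v, hv, rfl⟩
    have hv : v ∈ A.g 0 := hv
    simp only [Submodule.comap_coe, Set.mem_preimage, LinearMap.flip_apply, SetLike.mem_coe]
    rw [A.bk_bk_even_even hu hv (hW.C_le_g a k hy)]
    exact sub_mem (bk_mem_C hu (bk_mem_C hv hy)) (bk_mem_C hv (bk_mem_C hu hy))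
  exact hle hx

/-- `W 0 1` generates: each step of the descending sequence comes from a nonzero bracket
of homogeneous elements. -/
lemma exists_bk_ne_zero (hW : A.IsNaturalGrading W)
    {a : ZMod 2} {k l : ℕ} (hk : A.C a (k + 1) ≠ ⊥) (hl : A.C a l = ⊥) :
    ∃ x ∈ W 0 1, ∃ y ∈ W a (k + 1), A.bk x y ≠ 0 := by
  by_contra! h
  refine C_succ_ne hk hl (le_antisymm ?_ (hW.C_succ_le a _))
  refine Submodule.span_le.mpr ?_
  rintro _ ⟨x, hx, y, hy, rfl⟩
  have hx0 : x ∈ A.C 0 0 := hx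
  rw [hW.2.1] at hx0
  have hy0 := hy
  rw [hW.2.1] at hy0
  obtain ⟨x1, hx1, x2, hx2, rfl⟩ := Submodule.mem_sup.mp hx0
  obtain ⟨y1, hy1, y2, hy2, rfl⟩ := Submodule.mem_sup.mp hy0
  have e : A.bk (x1 + x2) (y1 + y2) = A.bk x2 y1 + A.bk (x1 + x2) y2 := by
    simp only [map_add, LinearMap.add_apply, h x1 hx1 y1 hy1]
    abel
  rw [SetLike.mem_coe, e]
  exact add_mem (hW.bk_C_one_mem hx2 (hW.W_le_C a k hy1)) (bk_mem_C hx hy2)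

/-- Every element of `g a` is a sum of homogeneous elements of degrees `1, …, k`, up to `C a k`. -/
lemma g_le_of_W_le (hW : A.IsNaturalGrading W)
    {a : ZMod 2} {l : ℕ} (hl : A.C a l = ⊥) {S : Submodule ℂ V}
    (h : ∀ k, W a k ≤ S) : A.g a ≤ S := by
  suffices H : ∀ k, A.g a ≤ S ⊔ A.C a k by simpa [hl] using H l
  intro k
  induction k with
  | zero => exact le_sup_right
  | succ k ih =>
    refine ih.trans (sup_le le_sup_left ?_)
    rw [hW.2.1 a k]
    exact sup_le_sup_right (h _) _

lemma exists_homogeneous_odd_bk_ne_zero (hW : A.IsNaturalGrading W)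
    {l : ℕ} (hl : A.C 1 l = ⊥) (hnd : A.NonDegenerate) :
    ∃ i j, ∃ x ∈ W 1 i, ∃ y ∈ W 1 j, A.bk x y ≠ 0 := by
  by_contra! h
  obtain ⟨x, hx, y, hy, hxy⟩ := hnd
  have h1 : ∀ i, ∀ u ∈ W 1 i, A.g 1 ≤ LinearMap.ker (A.bk u) := fun i u hu =>
    hW.g_le_of_W_le hl fun j v hv => h i j u hu v hv
  have h2 : A.g 1 ≤ LinearMap.ker (A.bk.flip y) :=
    hW.g_le_of_W_le hl fun i u hu => h1 i u hu hy
  exact hxy (h2 hx)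

lemma W_one_eq_pair (hW : A.IsNaturalGrading W) {x y : V} (hx : x ∈ W 0 1) (hy : y ∈ W 0 1)
    (hxy : A.bk x y ≠ 0) (hd : Module.finrank ℂ (W 0 1) = 2) [FiniteDimensional ℂ V] :
    W 0 1 = Submodule.span ℂ {x, y} := by
  have hli : LinearIndependent ℂ ![x, y] := by
    rw [LinearIndependent.pair_iff]
    intro a b hab
    have h1 : A.bk x (a • x + b • y) = b • A.bk x y := by
      simp [A.bk_even_self (hW.W_le_g 0 1 hx)]
    have h2 : A.bk (a • x + b • y) y = a • A.bk x y := by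
      simp [A.bk_even_self (hW.W_le_g 0 1 hy)]
    rw [hab, map_zero] at h1
    rw [hab, map_zero, LinearMap.zero_apply] at h2
    exact ⟨(smul_eq_zero.mp h2.symm).resolve_right hxy,
      (smul_eq_zero.mp h1.symm).resolve_right hxy⟩
  symm
  apply Submodule.eq_of_le_of_finrank_eq
  · rw [Submodule.span_le]
    rintro _ (rfl | rfl)
    exacts [hx, hy]
  · have := finrank_span_eq_card hli
    rw [Matrix.range_cons_cons_empty] at this
    simpa [hd] using this

lemma W_zero_eq_bot (hW : A.IsNaturalGrading W)
    (hfil : A.IsFiliform 3 4) {k : ℕ} (hk : 4 ≤ k) : W 0 k = ⊥ :=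
  hW.W_eq_bot hk hfil.2.2.2.2.2.1

lemma W_one_eq_bot (hW : A.IsNaturalGrading W)
    (hfil : A.IsFiliform 3 4) {k : ℕ} (hk : 5 ≤ k) : W 1 k = ⊥ :=
  hW.W_eq_bot hk hfil.2.2.2.2.2.2

variable [FiniteDimensional ℂ V]

lemma finrank_W_zero (hW : A.IsNaturalGrading W)
    (hfil : A.IsFiliform 3 4) : Module.finrank ℂ (W 0 1) = 2 ∧
    Module.finrank ℂ (W 0 2) = 1 ∧ Module.finrank ℂ (W 0 3) = 1 := by
  obtain ⟨-, hd, -, hne, -, hbot, -⟩ := hfil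
  have hne0 : ∀ k ≤ 2, A.C 0 k ≠ ⊥ := fun k hk h => hne (C_eq_bot_of_le hk h)
  have f0 := hW.finrank_C 0 0
  have f1 := hW.finrank_C 0 1
  have f2 := hW.finrank_C 0 2
  have f3 : Module.finrank ℂ (A.C 0 3) = 0 := by rw [hbot, finrank_bot]
  have hd : Module.finrank ℂ (A.C 0 0) = 4 := hd
  have p : ∀ k ≤ 2, 1 ≤ Module.finrank ℂ (W 0 (k + 1)) := fun k hk =>
    Submodule.one_le_finrank_iff.mpr (hW.W_ne_bot (hne0 k hk) hbot)
  have p1 := p 1 (by norm_num)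
  have p2 := p 2 le_rfl
  have p0 : 2 ≤ Module.finrank ℂ (W 0 1) := by
    by_contra hlt
    have h1 : Module.finrank ℂ (W 0 1) = 1 := le_antisymm (by omega) (p 0 (by norm_num))
    obtain ⟨x, hx, y, hy, hxy⟩ := hW.exists_bk_ne_zero (hne0 1 (by norm_num)) hbot
    have hx0 : x ≠ 0 := by
      rintro rfl
      simp at hxy
    obtain ⟨c, rfl⟩ := exists_smul_eq h1 hx hx0 hy
    simp [A.bk_even_self (hW.W_le_g 0 1 hx)] at hxy
  simp only [Nat.reduceAdd] at *
  omega

lemma finrank_W_one (hW : A.IsNaturalGrading W) (hfil : A.IsFiliform 3 4) {j : ℕ} (hj : j ≤ 3) :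
    Module.finrank ℂ (W 1 (j + 1)) = 1 := by
  obtain ⟨-, -, hd, -, hne, -, hbot⟩ := hfil
  have hne0 : ∀ k ≤ 3, A.C 1 k ≠ ⊥ := fun k hk h => hne (C_eq_bot_of_le hk h)
  have f0 := hW.finrank_C 1 0
  have f1 := hW.finrank_C 1 1
  have f2 := hW.finrank_C 1 2
  have f3 := hW.finrank_C 1 3
  have f4 : Module.finrank ℂ (A.C 1 4) = 0 := by rw [hbot, finrank_bot]
  have hd : Module.finrank ℂ (A.C 1 0) = 4 := hd
  have p : ∀ k ≤ 3, 1 ≤ Module.finrank ℂ (W 1 (k + 1)) := fun k hk =>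
    Submodule.one_le_finrank_iff.mpr (hW.W_ne_bot (hne0 k hk) hbot)
  have p0 := p 0 (by norm_num)
  have p1 := p 1 (by norm_num)
  have p2 := p 2 (by norm_num)
  have p3 := p 3 le_rfl
  interval_cases j <;> simp only [Nat.reduceAdd] at * <;> omega

lemma exists_even_generators (hW : A.IsNaturalGrading W) (hfil : A.IsFiliform 3 4) :
    ∃ x ∈ W 0 1, ∃ z ∈ W 0 1, A.bk x (A.bk x z) ≠ 0 ∧ A.bk z (A.bk x z) = 0 := by
  obtain ⟨d1, d2, d3⟩ := hW.finrank_W_zero hfil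
  obtain ⟨-, -, -, hne, -, hbot, -⟩ := hfil
  have hne1 : A.C 0 1 ≠ ⊥ := fun h => hne (C_eq_bot_of_le (by norm_num) h)
  obtain ⟨p, hp, q, hq, hpq⟩ := hW.exists_bk_ne_zero (k := 0) hne1 hbot
  obtain ⟨x, hx, e, he, hxe⟩ := hW.exists_bk_ne_zero (k := 1) hne hbot
  have he0 : e ≠ 0 := by
    rintro rfl
    simp at hxe
  have hself := A.bk_even_self (hW.W_le_g 0 1 hx)
  -- any direction can be corrected along `x` so as to commute with `e`
  have key : ∀ u ∈ W 0 1, A.bk x u ≠ 0 →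
      ∃ x ∈ W 0 1, ∃ z ∈ W 0 1, A.bk x (A.bk x z) ≠ 0 ∧ A.bk z (A.bk x z) = 0 := by
    intro u hu hxu
    obtain ⟨c, hc⟩ := exists_smul_eq d3 (hW.bk_mem hx he) hxe (hW.bk_mem hu he)
    have hxz : A.bk x (u - c • x) = A.bk x u := by simp [hself]
    obtain ⟨r, hr⟩ := exists_smul_eq d2 he he0 (hW.bk_mem hx hu)
    have hr0 : r ≠ 0 := by
      rintro rfl
      exact hxu (by rw [← hr, zero_smul])
    refine ⟨x, hx, u - c • x, sub_mem hu (Submodule.smul_mem _ _ hx), ?_, ?_⟩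
    · rw [hxz, ← hr, map_smul]
      exact smul_ne_zero hr0 hxe
    · rw [hxz, ← hr]
      simp [hc]
  by_cases hxp : A.bk x p = 0
  · by_cases hxq : A.bk x q = 0
    · exfalso
      have hx' := hx
      rw [hW.W_one_eq_pair hp hq hpq d1, Submodule.mem_span_pair] at hx'
      obtain ⟨a, b, hab⟩ := hx'
      have hpx : A.bk p x = 0 := by
        rw [A.bk_even_swap (hW.W_le_g 0 1 hp) (hW.W_le_g 0 1 hx), hxp, neg_zero]
      rw [← hab] at hpx hxq
      simp [A.bk_even_self (hW.W_le_g 0 1 hp), A.bk_even_self (hW.W_le_g 0 1 hq), hpq]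
        at hpx hxq
      rw [hpx, hxq] at hab
      exact hxe (by rw [← hab]; simp)
    · exact key q hq hxq
  · exact key p hp hxp

/-- A nonzero homogeneous odd element of degree at most three is moved by `W 0 1`. -/
lemma exists_bk_odd_ne_zero (hW : A.IsNaturalGrading W)
    (hfil : A.IsFiliform 3 4) {j : ℕ} (hj : j ≤ 2) {y : V}
    (hy : y ∈ W 1 (j + 1)) (hy0 : y ≠ 0) : ∃ x ∈ W 0 1, A.bk x y ≠ 0 := by
  have d := hW.finrank_W_one hfil (j := j) (by omega)
  obtain ⟨-, -, -, -, hne, -, hbot⟩ := hfil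
  obtain ⟨x, hx, u, hu, hxu⟩ := hW.exists_bk_ne_zero (a := 1) (k := j)
    (fun h => hne (C_eq_bot_of_le (by omega) h)) hbot
  refine ⟨x, hx, fun h => hxu ?_⟩
  obtain ⟨c, rfl⟩ := exists_smul_eq d hy hy0 hu
  rw [map_smul, h, smul_zero]

lemma bk_odd_self_ne_zero (hW : A.IsNaturalGrading W)
    (hfil : A.IsFiliform 3 4) (hnd : A.NonDegenerate) {y : V}
    (hy : y ∈ W 1 1) (hy0 : y ≠ 0) : A.bk y y ≠ 0 := by
  intro h0
  have hyg := hW.W_le_g 1 1 hy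
  have d1 := hW.finrank_W_one hfil (j := 0) (by norm_num)
  have d2 := hW.finrank_W_one hfil (j := 1) (by norm_num)
  obtain ⟨x, hx, hxy⟩ := hW.exists_bk_odd_ne_zero hfil (j := 0) (by norm_num) hy hy0
  have hxyg : A.bk x y ∈ A.g 1 := hW.W_le_g 1 2 (hW.bk_mem hx hy)
  have h12 : A.bk y (A.bk x y) = 0 := by
    have h := A.bk_even_bk_odd_odd (hW.W_le_g 0 1 hx) hyg hyg
    rw [h0, map_zero, A.bk_odd_comm hxyg hyg, ← two_smul ℂ] at h
    exact (smul_eq_zero.mp h.symm).resolve_left two_ne_zero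
  obtain ⟨i, j, u, hu, v, hv, huv⟩ :=
    hW.exists_homogeneous_odd_bk_ne_zero hfil.2.2.2.2.2.2 hnd
  have hij : i + j < 4 := by
    by_contra hij
    have hm := hW.bk_mem hu hv
    rw [show (1 + 1 : ZMod 2) = 0 from rfl, hW.W_zero_eq_bot hfil (not_lt.mp hij),
      Submodule.mem_bot] at hm
    exact huv hm
  have hi : i ≠ 0 := by
    rintro rfl
    rw [hW.1, Submodule.mem_bot] at hu
    simp [hu] at huv
  have hj : j ≠ 0 := by
    rintro rfl
    rw [hW.1, Submodule.mem_bot] at hv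
    simp [hv] at huv
  obtain ⟨rfl, rfl⟩ | ⟨rfl, rfl⟩ | ⟨rfl, rfl⟩ :
      (i = 1 ∧ j = 1) ∨ (i = 1 ∧ j = 2) ∨ (i = 2 ∧ j = 1) := by omega
  · obtain ⟨a, rfl⟩ := exists_smul_eq d1 hy hy0 hu
    obtain ⟨b, rfl⟩ := exists_smul_eq d1 hy hy0 hv
    simp [h0] at huv
  · obtain ⟨a, rfl⟩ := exists_smul_eq d1 hy hy0 hu
    obtain ⟨b, rfl⟩ := exists_smul_eq d2 (hW.bk_mem hx hy) hxy hv
    simp [h12] at huv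
  · obtain ⟨a, rfl⟩ := exists_smul_eq d1 hy hy0 hv
    obtain ⟨b, rfl⟩ := exists_smul_eq d2 (hW.bk_mem hx hy) hxy hu
    simp [A.bk_odd_comm hxyg hyg, h12] at huv

/-- Homogeneous generators; `z` acts on the odd part only through its bracket with the
element of degree three. -/
lemma exists_generators (hW : A.IsNaturalGrading W)
    (hfil : A.IsFiliform 3 4) (hnd : A.NonDegenerate) :
    ∃ x ∈ W 0 1, ∃ z ∈ W 0 1, ∃ y ∈ W 1 1,
      A.bk x (A.bk x z) ≠ 0 ∧ A.bk z (A.bk x z) = 0 ∧ A.bk y y ≠ 0 ∧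
      A.bk x (A.bk x (A.bk x y)) ≠ 0 ∧ A.bk z y = 0 ∧ A.bk z (A.bk x y) = 0 := by
  obtain ⟨x, hx, z, hz, hxxz, hzxz⟩ := hW.exists_even_generators hfil
  obtain ⟨d1, d2, d3⟩ := hW.finrank_W_zero hfil
  have hxz : A.bk x z ≠ 0 := fun h => hxxz (by rw [h, map_zero])
  have hpair := hW.W_one_eq_pair hx hz hxz d1
  have hxg := hW.W_le_g 0 1 hx
  have hzg := hW.W_le_g 0 1 hz
  obtain ⟨y, hy, hy0⟩ := Submodule.exists_mem_ne_zero_of_ne_bot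
    (hW.W_ne_bot (k := 0) (fun h => hfil.2.2.2.2.1 (C_eq_bot_of_le (by norm_num) h))
      hfil.2.2.2.2.2.2)
  have hyg := hW.W_le_g 1 1 hy
  have hyy := hW.bk_odd_self_ne_zero hfil hnd hy hy0
  obtain ⟨a, ha⟩ := exists_smul_eq d2 (hW.bk_mem hx hz) hxz (hW.bk_mem hy hy)
  have ha0 : a ≠ 0 := by
    rintro rfl
    exact hyy (by rw [← ha, zero_smul])
  -- the bracket of `w` with `[y, y]`, seen through the super Jacobi identity
  have hjac : ∀ w ∈ W 0 1, a • A.bk w (A.bk x z) = (2 : ℂ) • A.bk (A.bk w y) y := by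
    intro w hw
    have hwy : A.bk w y ∈ A.g 1 := hW.W_le_g 1 2 (hW.bk_mem hw hy)
    have h := A.bk_even_bk_odd_odd (hW.W_le_g 0 1 hw) hyg hyg
    rw [← ha, map_smul, A.bk_odd_comm hyg hwy] at h
    rw [h, two_smul]
  have hzy : A.bk z y = 0 := by
    by_contra hzy
    have h1 := hjac z hz
    rw [hzxz, smul_zero] at h1
    have h1 := (smul_eq_zero.mp h1.symm).resolve_left two_ne_zero
    obtain ⟨c, hc⟩ := exists_smul_eq (hW.finrank_W_one hfil (j := 1) (by norm_num))
      (hW.bk_mem hz hy) hzy (hW.bk_mem hx hy)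
    have h2 := hjac x hx
    rw [← hc, map_smul, LinearMap.smul_apply, h1, smul_zero, smul_zero] at h2
    exact smul_ne_zero ha0 hxxz h2
  have hxy : A.bk x y ≠ 0 := by
    intro h
    have h2 := hjac x hx
    rw [h, map_zero, LinearMap.zero_apply, smul_zero] at h2
    exact smul_ne_zero ha0 hxxz h2
  have hxyW : A.bk x y ∈ W 1 2 := hW.bk_mem hx hy
  have hzxy : A.bk z (A.bk x y) = 0 := by
    have h := A.bk_bk_odd_self hyg
    rw [← ha, map_smul, LinearMap.smul_apply, A.bk_bk_even_even hxg hzg hyg, hzy, map_zero,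
      zero_sub] at h
    exact neg_eq_zero.mp ((smul_eq_zero.mp h).resolve_left ha0)
  have hxxy : A.bk x (A.bk x y) ≠ 0 := by
    intro h
    obtain ⟨w, hw, hne⟩ := hW.exists_bk_odd_ne_zero hfil (j := 1) (by norm_num) hxyW hxy
    rw [hpair, Submodule.mem_span_pair] at hw
    obtain ⟨b, c, rfl⟩ := hw
    simp [h, hzxy] at hne
  have hxxyW : A.bk x (A.bk x y) ∈ W 1 3 := hW.bk_mem hx hxyW
  by_cases hxxxy : A.bk x (A.bk x (A.bk x y)) = 0
  · have hzxxy : A.bk z (A.bk x (A.bk x y)) ≠ 0 := by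
      intro h
      obtain ⟨w, hw, hne⟩ := hW.exists_bk_odd_ne_zero hfil (j := 2) le_rfl hxxyW hxxy
      rw [hpair, Submodule.mem_span_pair] at hw
      obtain ⟨b, c, rfl⟩ := hw
      simp [h, hxxxy] at hne
    refine ⟨x + z, add_mem hx hz, z, hz, y, hy, ?_⟩
    simp [A.bk_even_self hzg, hzy, hzxy, hzxz, hxxxy, hxxz, hyy, hzxxy]
  · exact ⟨x, hx, z, hz, y, hy, hxxz, hzxz, hyy, hxxxy, hzy, hzxy⟩

lemma exists_normalized_generators (hW : A.IsNaturalGrading W)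
    (hfil : A.IsFiliform 3 4) (hnd : A.NonDegenerate) :
    ∃ ε : ℂ, (ε = 0 ∨ ε = 1) ∧ ∃ x ∈ W 0 1, ∃ z ∈ W 0 1, ∃ y ∈ W 1 1,
      A.bk x (A.bk x z) ≠ 0 ∧ A.bk z (A.bk x z) = 0 ∧ A.bk y y = A.bk x z ∧
      A.bk x (A.bk x (A.bk x y)) ≠ 0 ∧ A.bk z y = 0 ∧ A.bk z (A.bk x y) = 0 ∧
      A.bk z (A.bk x (A.bk x y)) = ε • A.bk x (A.bk x (A.bk x y)) := by
  obtain ⟨x, hx, z, hz, y, hy, hxxz, hzxz, hyy, hxxxy, hzy, hzxy⟩ :=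
    hW.exists_generators hfil hnd
  have hxz : A.bk x z ≠ 0 := fun h => hxxz (by rw [h, map_zero])
  have hxxy := hW.bk_mem hx (hW.bk_mem hx hy)
  obtain ⟨a, ha⟩ := exists_smul_eq (hW.finrank_W_zero hfil).2.1 (hW.bk_mem hx hz) hxz
    (hW.bk_mem hy hy)
  have ha0 : a ≠ 0 := by
    rintro rfl
    exact hyy (by rw [← ha, zero_smul])
  obtain ⟨t, ht⟩ := exists_smul_eq (hW.finrank_W_one hfil le_rfl) (hW.bk_mem hx hxxy) hxxxy
    (hW.bk_mem hz hxxy)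
  obtain ⟨ε, s, hε, hs0, hst⟩ : ∃ ε s : ℂ, (ε = 0 ∨ ε = 1) ∧ s ≠ 0 ∧ s * t = ε := by
    by_cases ht0 : t = 0
    · exact ⟨0, 1, Or.inl rfl, one_ne_zero, by simp [ht0]⟩
    · exact ⟨1, t⁻¹, Or.inr rfl, inv_ne_zero ht0, inv_mul_cancel₀ ht0⟩
  obtain ⟨c, hc⟩ := IsAlgClosed.exists_pow_nat_eq (s / a) two_pos
  have hc0 : c ≠ 0 := by
    rintro rfl
    exact div_ne_zero hs0 ha0 (by rw [← hc]; norm_num)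
  refine ⟨ε, hε, x, hx, s • z, Submodule.smul_mem _ _ hz, c • y, Submodule.smul_mem _ _ hy,
    ?_, ?_, ?_, ?_, ?_, ?_, ?_⟩
  · simpa [hs0] using hxxz
  · simp [hzxz]
  · simp only [map_smul, LinearMap.smul_apply, smul_smul, ← ha]
    congr 1
    field_simp at hc
    linear_combination hc
  · simpa [hc0] using hxxxy
  · simp [hzy]
  · simp [hzxy]
  · simp only [map_smul, LinearMap.smul_apply, smul_smul, ← ht, ← hst]
    congr 1
    ring

/-- Homogeneous vectors of the right degrees form an adapted basis. -/
lemma isAdaptedBasis (hW : A.IsNaturalGrading W)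
    (hfil : A.IsFiliform 3 4) {X Y : ℕ → V} (h0 : X 0 ∈ W 0 1)
    (h1 : X 1 ∈ W 0 1) (h2 : X 2 = A.bk (X 0) (X 1)) (h3 : X 3 ∈ W 0 3) (h2' : X 2 ≠ 0)
    (h3' : X 3 ≠ 0) (hY : ∀ j, 1 ≤ j → j ≤ 4 → Y j ∈ W 1 j ∧ Y j ≠ 0) :
    A.IsAdaptedBasis 3 4 X Y := by
  obtain ⟨d1, d2, d3⟩ := hW.finrank_W_zero hfil
  have h2W : X 2 ∈ W 0 2 := h2 ▸ hW.bk_mem h0 h1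
  set f : Fin (3 + 1) ⊕ Fin 4 → V :=
    Sum.elim (fun i : Fin (3 + 1) => X i.val) (fun j : Fin 4 => Y (j.val + 1)) with hf
  have hXs : ∀ i, i ≤ 3 → X i ∈ Submodule.span ℂ (Set.range f) := fun i hi =>
    Submodule.subset_span ⟨Sum.inl ⟨i, by omega⟩, rfl⟩
  have hYs : ∀ j, 1 ≤ j → j ≤ 4 → Y j ∈ Submodule.span ℂ (Set.range f) := fun j hj hj' =>
    Submodule.subset_span ⟨Sum.inr ⟨j - 1, by omega⟩, by simp [hf, Nat.sub_add_cancel hj]⟩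
  have line : ∀ {S : Submodule ℂ V} {v : V}, Module.finrank ℂ S = 1 → v ∈ S → v ≠ 0 →
      v ∈ Submodule.span ℂ (Set.range f) → S ≤ Submodule.span ℂ (Set.range f) := by
    intro S v hS hv hv0 hvs u hu
    obtain ⟨c, rfl⟩ := exists_smul_eq hS hv hv0 hu
    exact Submodule.smul_mem _ _ hvs
  have hg0 : A.g 0 ≤ Submodule.span ℂ (Set.range f) := by
    refine hW.g_le_of_W_le hfil.2.2.2.2.2.1 fun k => ?_
    rcases Nat.lt_or_ge k 4 with hk | hk
    · interval_cases k
      · simp [hW.1]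
      · rw [hW.W_one_eq_pair h0 h1 (h2 ▸ h2') d1, Submodule.span_le]
        rintro _ (rfl | rfl)
        exacts [hXs 0 (by norm_num), hXs 1 (by norm_num)]
      · exact line d2 h2W h2' (hXs 2 (by norm_num))
      · exact line d3 h3 h3' (hXs 3 le_rfl)
    · simp [hW.W_zero_eq_bot hfil hk]
  have hg1 : A.g 1 ≤ Submodule.span ℂ (Set.range f) := by
    refine hW.g_le_of_W_le hfil.2.2.2.2.2.2 fun k => ?_
    rcases Nat.lt_or_ge k 5 with hk | hk
    · rcases k with _ | k
      · simp [hW.1]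
      · obtain ⟨hm, hne⟩ := hY (k + 1) (by omega) (by omega)
        exact line (hW.finrank_W_one hfil (by omega)) hm hne (hYs _ (by omega) (by omega))
    · simp [hW.W_one_eq_bot hfil hk]
  have htop : ⊤ ≤ Submodule.span ℂ (Set.range f) := by
    rw [← A.compl.sup_eq_top]
    exact sup_le hg0 hg1
  refine ⟨?_, fun j hj hj' => hW.W_le_g 1 j (hY j hj hj').1, ?_, top_le_iff.mp htop⟩
  · intro i hi
    interval_cases i
    exacts [hW.W_le_g _ _ h0, hW.W_le_g _ _ h1, hW.W_le_g _ _ h2W, hW.W_le_g _ _ h3]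
  · exact linearIndependent_of_top_le_span_of_card_eq_finrank htop
      (by simp [A.finrank_eq hfil])

/-- The laws (I) and (II) are the members `ε = 0` and `ε = 1` of a single family. -/
lemma exists_law (hW : A.IsNaturalGrading W) (hfil : A.IsFiliform 3 4) (hnd : A.NonDegenerate) :
    ∃ ε : ℂ, (ε = 0 ∨ ε = 1) ∧ ∃ X Y : ℕ → V, A.IsAdaptedBasis 3 4 X Y ∧
      (∀ i j : ℕ, i ≤ 3 → j ≤ 3 → A.bk (X i) (X j) =
        if i = 0 ∧ 1 ≤ j ∧ j ≤ 2 then X (j + 1)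
        else if j = 0 ∧ 1 ≤ i ∧ i ≤ 2 then -X (i + 1) else 0) ∧
      (∀ i j : ℕ, i ≤ 3 → 1 ≤ j → j ≤ 4 → A.bk (X i) (Y j) =
        if i = 0 ∧ j ≤ 3 then Y (j + 1)
        else if i = 1 ∧ j = 3 then ε • Y 4
        else if i = 2 ∧ j = 2 then -(ε • Y 4)
        else if i = 3 ∧ j = 1 then ε • Y 4 else 0) ∧
      (∀ i j : ℕ, 1 ≤ i → i ≤ 4 → 1 ≤ j → j ≤ 4 → A.bk (Y i) (Y j) =
        if i = 1 ∧ j = 1 then X 2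
        else if (i = 1 ∧ j = 2) ∨ (i = 2 ∧ j = 1) then (1/2 : ℂ) • X 3 else 0) := by
  obtain ⟨ε, hε, x, hx, z, hz, y, hy, hxxz, hzxz, hyy, hxxxy, hzy, hzxy, hzxxy⟩ :=
    hW.exists_normalized_generators hfil hnd
  let X : ℕ → V
    | 0 => x
    | 1 => z
    | 2 => A.bk x z
    | _ => A.bk x (A.bk x z)
  let Y : ℕ → V
    | 0 => 0
    | 1 => y
    | 2 => A.bk x y
    | 3 => A.bk x (A.bk x y)
    | _ => A.bk x (A.bk x (A.bk x y))
  have hx2 : A.bk x z ∈ W 0 2 := hW.bk_mem hx hz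
  have hx3 : A.bk x (A.bk x z) ∈ W 0 3 := hW.bk_mem hx hx2
  have hy2 : A.bk x y ∈ W 1 2 := hW.bk_mem hx hy
  have hy3 : A.bk x (A.bk x y) ∈ W 1 3 := hW.bk_mem hx hy2
  have hy4 : A.bk x (A.bk x (A.bk x y)) ∈ W 1 4 := hW.bk_mem hx hy3
  have hYW : ∀ j, 1 ≤ j → j ≤ 4 → Y j ∈ W 1 j := by
    intro j hj hj'
    interval_cases j
    exacts [hy, hy2, hy3, hy4]
  have hxg := hW.W_le_g 0 1 hx
  have hzg := hW.W_le_g 0 1 hz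
  have hx2g := hW.W_le_g 0 2 hx2
  have hx3g := hW.W_le_g 0 3 hx3
  have hyg := hW.W_le_g 1 1 hy
  have hy2g := hW.W_le_g 1 2 hy2
  have even_zero : ∀ {i j : ℕ} {u v : V}, u ∈ W 0 i → v ∈ W 0 j → 4 ≤ i + j →
      A.bk u v = 0 := by
    intro i j u v hu hv hij
    have hm := hW.bk_mem hu hv
    rwa [add_zero, hW.W_zero_eq_bot hfil hij, Submodule.mem_bot] at hm
  have mixed_zero : ∀ {i j : ℕ} {u v : V}, u ∈ W 0 i → v ∈ W 1 j → 5 ≤ i + j →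
      A.bk u v = 0 := by
    intro i j u v hu hv hij
    have hm := hW.bk_mem hu hv
    rwa [zero_add, hW.W_one_eq_bot hfil hij, Submodule.mem_bot] at hm
  have odd_zero : ∀ {i j : ℕ} {u v : V}, u ∈ W 1 i → v ∈ W 1 j → 4 ≤ i + j →
      A.bk u v = 0 := by
    intro i j u v hu hv hij
    have hm := hW.bk_mem hu hv
    rwa [show (1 + 1 : ZMod 2) = 0 from rfl, hW.W_zero_eq_bot hfil hij,
      Submodule.mem_bot] at hm
  have x2y : A.bk (A.bk x z) y = 0 := by
    rw [A.bk_bk_even_even hxg hzg hyg, hzy, hzxy, map_zero, sub_zero]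
  have x2y2 : A.bk (A.bk x z) (A.bk x y) = -(ε • A.bk x (A.bk x (A.bk x y))) := by
    rw [A.bk_bk_even_even hxg hzg hy2g, hzxy, hzxxy, map_zero, zero_sub]
  have x3y : A.bk (A.bk x (A.bk x z)) y = ε • A.bk x (A.bk x (A.bk x y)) := by
    rw [A.bk_bk_even_even hxg hx2g hyg, x2y, x2y2, map_zero, zero_sub, neg_neg]
  have yy2 : A.bk y (A.bk x y) = (1 / 2 : ℂ) • A.bk x (A.bk x z) := by
    have h := A.bk_even_bk_odd_odd hxg hyg hyg
    rw [hyy, A.bk_odd_comm hy2g hyg] at h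
    rw [h]
    module
  refine ⟨ε, hε, X, Y, ?_, ?_, ?_, ?_⟩
  · refine hW.isAdaptedBasis hfil hx hz rfl hx3 (fun h => hxxz ?_) hxxz
      fun j hj hj' => ⟨hYW j hj hj', fun h => hxxxy ?_⟩
    · rw [show A.bk x z = 0 from h, map_zero]
    · interval_cases j <;> simp only [Y] at h <;> simp [h]
  · intro i j hi hj
    interval_cases i <;> interval_cases j <;>
      simp [X, A.bk_even_self hxg, A.bk_even_self hzg, A.bk_even_self hx2g,
        A.bk_even_self hx3g, hzxz, A.bk_swap_even hxg hzg, A.bk_swap_even hxg hx2g,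
        A.bk_swap_even hzg hx2g, even_zero hx hx3, even_zero hz hx3, even_zero hx2 hx3,
        even_zero hx3 hx, even_zero hx3 hz, even_zero hx3 hx2]
  · intro i j hi hj hj'
    have hXW : X i ∈ W 0 (max i 1) := by
      interval_cases i
      exacts [hx, hz, hx2, hx3]
    rcases Nat.lt_or_ge (max i 1 + j) 5 with hij | hij
    · interval_cases i <;> interval_cases j <;>
        first
        | omega
        | simp [X, Y, hzy, hzxy, hzxxy, x2y, x2y2, x3y]
    · rw [mixed_zero hXW (hYW j hj hj') hij, if_neg (by omega), if_neg (by omega),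
        if_neg (by omega), if_neg (by omega)]
  · intro i j hi hi' hj hj'
    rcases Nat.lt_or_ge (i + j) 4 with hij | hij
    · obtain ⟨rfl, rfl⟩ | ⟨rfl, rfl⟩ | ⟨rfl, rfl⟩ :
          (i = 1 ∧ j = 1) ∨ (i = 1 ∧ j = 2) ∨ (i = 2 ∧ j = 1) := by omega
      · simpa [X, Y] using hyy
      · simpa [X, Y] using yy2
      · simpa [X, Y, A.bk_odd_comm hy2g hyg] using yy2
    · rw [odd_zero (hYW i hi hi') (hYW j hj hj') hij, if_neg (by omega), if_neg (by omega)]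

end IsNaturalGrading

end Grading

section AdaptedBasis

variable {V : Type*} [AddCommGroup V] [Module ℂ V] {A : LieSuperAlg V} {n m : ℕ} {X Y : ℕ → V}

namespace IsAdaptedBasis

lemma X_ne_zero (hb : A.IsAdaptedBasis n m X Y) {i : ℕ} (hi : i ≤ n) : X i ≠ 0 := by
  simpa using hb.2.2.1.ne_zero (Sum.inl ⟨i, Nat.lt_succ_of_le hi⟩)

lemma Y_ne_zero (hb : A.IsAdaptedBasis n m X Y) {j : ℕ} (hj : 1 ≤ j) (hj' : j ≤ m) : Y j ≠ 0 := by
  have h := hb.2.2.1.ne_zero (Sum.inr ⟨j - 1, by omega⟩)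
  simpa [Nat.sub_add_cancel hj] using h

lemma spans (hb : A.IsAdaptedBasis n m X Y) :
    A.g 0 ≤ Submodule.span ℂ (Set.range fun i : Fin (n + 1) => X i.val) ∧
    A.g 1 ≤ Submodule.span ℂ (Set.range fun j : Fin m => Y (j.val + 1)) := by
  have htop := hb.2.2.2
  rw [Set.Sum.elim_range, Submodule.span_union] at htop
  have hX : Submodule.span ℂ (Set.range fun i : Fin (n + 1) => X i.val) ≤ A.g 0 := by
    rw [Submodule.span_le]
    rintro _ ⟨i, rfl⟩
    exact hb.1 _ (Nat.le_of_lt_succ i.2)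
  have hY : Submodule.span ℂ (Set.range fun j : Fin m => Y (j.val + 1)) ≤ A.g 1 := by
    rw [Submodule.span_le]
    rintro _ ⟨j, rfl⟩
    exact hb.2.1 _ (by omega) (by omega)
  constructor
  · intro u hu
    obtain ⟨a, ha, b, hb', rfl⟩ := Submodule.mem_sup.mp (htop ▸ Submodule.mem_top : u ∈ _ ⊔ _)
    have hb0 : b ∈ A.g 0 := (Submodule.add_mem_iff_right _ (hX ha)).mp hu
    rwa [Submodule.disjoint_def.mp A.compl.disjoint b hb0 (hY hb'), add_zero]
  · intro u hu
    obtain ⟨a, ha, b, hb', rfl⟩ := Submodule.mem_sup.mp (htop ▸ Submodule.mem_top : u ∈ _ ⊔ _)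
    have ha1 : a ∈ A.g 1 := (Submodule.add_mem_iff_left _ (hY hb')).mp hu
    rwa [Submodule.disjoint_def.mp A.compl.disjoint a (hX ha) ha1, zero_add]

end IsAdaptedBasis

end AdaptedBasis

end LieSuperAlg

section Invariants

variable {V : Type*} [AddCommGroup V] [Module ℂ V] {A : LieSuperAlg V}

/-- In the law (I) the derived algebra of the even part annihilates the odd part. -/
lemma Law34I.bk_bk_eq_zero (h : Law34I A) {u v w : V} (hu : u ∈ A.g 0) (hv : v ∈ A.g 0)
    (hw : w ∈ A.g 1) : A.bk (A.bk u v) w = 0 := by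
  obtain ⟨X, Y, hb, h00, h01, -⟩ := h
  obtain ⟨a, rfl⟩ := (Submodule.mem_span_range_iff_exists_fun ℂ).mp (hb.spans.1 hu)
  obtain ⟨b, rfl⟩ := (Submodule.mem_span_range_iff_exists_fun ℂ).mp (hb.spans.1 hv)
  obtain ⟨c, rfl⟩ := (Submodule.mem_span_range_iff_exists_fun ℂ).mp (hb.spans.2 hw)
  simp only [map_sum, LinearMap.sum_apply, map_smul, LinearMap.smul_apply]
  refine Finset.sum_eq_zero fun k _ => ?_
  suffices H : ∀ i j : Fin (3 + 1), A.bk (A.bk (X i) (X j)) (Y (k + 1)) = 0 by simp [H]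
  intro i j
  rw [h00 i j (by omega) (by omega)]
  split_ifs
  · rw [h01 _ _ (by omega) (by omega) (by omega), if_neg (by omega)]
  · rw [map_neg, LinearMap.neg_apply, h01 _ _ (by omega) (by omega) (by omega),
      if_neg (by omega), neg_zero]
  · simp

lemma not_law34I_and_law34II (h : Law34I A) (h' : Law34II A) : False := by
  obtain ⟨X, Y, hb, h00, h01, -⟩ := h'
  have hz := h.bk_bk_eq_zero (hb.1 0 (by norm_num)) (hb.1 1 (by norm_num))
    (hb.2.1 2 (by norm_num) (by norm_num))
  have h2 : A.bk (X 0) (X 1) = X 2 := by simp [h00]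
  have h4 : A.bk (X 2) (Y 2) = -Y 4 := by simp [h01]
  rw [h2, h4, neg_eq_zero] at hz
  exact hb.Y_ne_zero (by norm_num) le_rfl hz

/-- The products of (III) violate the super Jacobi identity on `X₁, Y₁, Y₁`, so no Lie
superalgebra satisfies them. -/
lemma not_law34III : ¬ Law34III A := by
  rintro ⟨X, Y, hb, h00, h01, h11⟩
  have hY1 := hb.2.1 1 le_rfl (by norm_num)
  have h := A.bk_even_bk_odd_odd (hb.1 1 (by norm_num)) hY1 hY1
  have e1 : A.bk (Y 1) (Y 1) = X 2 := by simp [h11]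
  have e2 : A.bk (X 1) (X 2) = 0 := by simp [h00]
  have e3 : A.bk (X 1) (Y 1) = Y 2 := by simp [h01]
  have e4 : A.bk (Y 1) (Y 2) = (1 / 2 : ℂ) • X 3 := by simp [h11]
  have e5 : A.bk (Y 2) (Y 1) = (1 / 2 : ℂ) • X 3 := by simp [h11]
  rw [e1, e2, e3, e4, e5, ← add_smul] at h
  norm_num at h
  exact hb.X_ne_zero le_rfl h.symm

end Invariants

/-- Every non-degenerate naturally graded filiform Lie superalgebra with
`dim g₀ = 4` and `dim g₁ = 4` is isomorphic to exactly one of the three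
pairwise non-isomorphic superalgebras (I), (II), (III). -/
theorem stmt4 {V : Type*} [AddCommGroup V] [Module ℂ V] [FiniteDimensional ℂ V] (A : LieSuperAlg V)
    (hfil : A.IsFiliform 3 4) (hnd : A.NonDegenerate) (hng : A.NaturallyGraded) :
    (Law34I A ∨ Law34II A ∨ Law34III A) ∧
      ¬(Law34I A ∧ Law34II A) ∧ ¬(Law34I A ∧ Law34III A) ∧ ¬(Law34II A ∧ Law34III A) := by
  refine ⟨?_, fun h => not_law34I_and_law34II h.1 h.2,
    fun h => not_law34III h.2, fun h => not_law34III h.2⟩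
  obtain ⟨W, hW⟩ := hng
  obtain ⟨ε, rfl | rfl, X, Y, hb, h00, h01, h11⟩ :=
    LieSuperAlg.IsNaturalGrading.exists_law (A := A) (W := W) hW hfil hnd
  · exact Or.inl ⟨X, Y, hb, h00, by simpa using h01, h11⟩
  · exact Or.inr (Or.inl ⟨X, Y, hb, h00, by simpa using h01, h11⟩)
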